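/- In the lower-indexed Behrens algebra R, the images of the admissible monomials Q_{a_1} Q_{a_2} ... Q_{a_m} (over all lengths m >= 0, including the empty monomial 1) are linearly independent over F_2; consequently the admissible monomials form an F_2-basis of R. -/

import Mathlib

/-!
STATEMENT 1: in the lower-indexed Behrens algebra, the images of the admissible
monomials (over all lengths, including the empty monomial `1`) are linearly
independent over `F₂`; consequently they form an `F₂`-basis of `R`
(i.e. they are linearly independent and span).
-/

noncomputable section

open scoped BigOperators

/-- The generator `Q a` of the free algebra. -/
def Q (a : ℕ) : FreeAlgebra (ZMod 2) ℕ := FreeAlgebra.ι (ZMod 2) a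

/-- The mod 2 binomial coefficient `C(a+b-2c-2, b-c)`, taken to be `0` unless the
(integer) arguments are nonnegative. -/
def behrensCoeff (a b c : ℕ) : ZMod 2 :=
  if c ≤ b ∧ 2 * c + 2 ≤ a + b then ((a + b - 2 * c - 2).choose (b - c) : ZMod 2) else 0

/-- The right hand side of the Behrens relation for `Q a * Q b`:
`∑_{c ≥ 0, 3c < a + 2b - 1} C(a+b-2c-2, b-c) • Q (a+2b-2c) * Q c`. -/
def behrensRHS (a b : ℕ) : FreeAlgebra (ZMod 2) ℕ :=
  ∑ c ∈ Finset.range (a + 2 * b),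
    if 3 * c + 1 < a + 2 * b then behrensCoeff a b c • (Q (a + 2 * b - 2 * c) * Q c) else 0

/-- The Behrens relations, for all `a ≤ b + 1`. -/
inductive BehrensRel : FreeAlgebra (ZMod 2) ℕ → FreeAlgebra (ZMod 2) ℕ → Prop
  | mk (a b : ℕ) (h : a ≤ b + 1) : BehrensRel (Q a * Q b) (behrensRHS a b)

/-- The lower-indexed Behrens algebra: the quotient of the free algebra by the two-sided
ideal generated by the Behrens relations. -/
abbrev BehrensAlgebra : Type := RingQuot BehrensRel

/-- The quotient map from the free algebra to the Behrens algebra. -/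
def toBehrens : FreeAlgebra (ZMod 2) ℕ →ₐ[ZMod 2] BehrensAlgebra :=
  RingQuot.mkAlgHom (ZMod 2) BehrensRel

/-- The monomial `Q a₁ * Q a₂ * ⋯ * Q aₘ` associated to a word `(a₁, …, aₘ)`;
the empty word gives `1`. -/
def mon (L : List ℕ) : FreeAlgebra (ZMod 2) ℕ := (L.map Q).prod

/-- A word `(a₁, …, aₘ)` is admissible if `aᵢ ≥ aᵢ₊₁ + 2` for all `i < m`. -/
def Admissible (L : List ℕ) : Prop := L.Chain' (fun a b => b + 2 ≤ a)

namespace Behrens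

open MvPolynomial

/-- Polynomials in countably many variables over the field with two elements. -/
abbrev Poly : Type := MvPolynomial ℕ (ZMod 2)

theorem add_self_poly (p : Poly) : p + p = 0 := CharTwo.add_self_eq_zero p

/-- The substitution `x_j ↦ x_j (x_j + x_i)`. -/
def psi (i j : ℕ) : Poly →ₐ[ZMod 2] Poly :=
  aeval fun k => if k = j then X j * (X j + X i) else X k

/-- The substitution `x_i ↦ x_j`, `x_j ↦ x_i (x_i + x_j)`. -/
def alphaHom (i j : ℕ) : Poly →ₐ[ZMod 2] Poly :=
  aeval fun k => if k = i then X j else if k = j then X i * (X i + X j) else X k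

/-- The substitution `x_i ↦ x_i + x_j`, `x_j ↦ x_i x_j`. -/
def betaHom (i j : ℕ) : Poly →ₐ[ZMod 2] Poly :=
  aeval fun k => if k = i then X i + X j else if k = j then X i * X j else X k

@[simp] theorem psi_X (i j k : ℕ) :
    psi i j (X k) = if k = j then X j * (X j + X i) else X k := by
  simp [psi]

@[simp] theorem alphaHom_X (i j k : ℕ) :
    alphaHom i j (X k) =
      if k = i then X j else if k = j then X i * (X i + X j) else X k := by
  simp [alphaHom]

@[simp] theorem betaHom_X (i j k : ℕ) :
    betaHom i j (X k) = if k = i then X i + X j else if k = j then X i * X j else X k := by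
  simp [betaHom]

theorem psi_injective {i j : ℕ} (hij : i ≠ j) : Function.Injective (psi i j) := by
  let T : Poly →ₐ[ZMod 2] Polynomial Poly :=
    aeval fun k => if k = j then Polynomial.X else Polynomial.C (X k)
  let q : Polynomial Poly := Polynomial.X * (Polynomial.X + Polynomial.C (X i))
  have hT : Function.Injective T := by
    have h : ∀ p, Polynomial.eval (X j) (T p) = p := by
      intro p
      have : ((Polynomial.aeval (X j : Poly)).restrictScalars (ZMod 2)).comp T
          = AlgHom.id (ZMod 2) Poly := by
        apply MvPolynomial.algHom_ext
        intro k
        by_cases hk : k = j <;> simp [T, hk]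
      have := congrArg (fun f => f p) this
      simpa [Polynomial.aeval_def] using this
    exact Function.LeftInverse.injective h
  have hcomp : ∀ p, T (psi i j p) = (T p).comp q := by
    intro p
    have : T.comp (psi i j) = ((Polynomial.aeval q).restrictScalars (ZMod 2)).comp T := by
      apply MvPolynomial.algHom_ext
      intro k
      by_cases hk : k = j <;> simp [T, hk, q, hij]
    have := congrArg (fun f => f p) this
    simpa [Polynomial.comp, Polynomial.aeval_def, Polynomial.eval₂_eq_eval_map] using this
  rw [injective_iff_map_eq_zero]
  intro p hp
  have h0 : (T p).comp q = 0 := by rw [← hcomp, hp, map_zero]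
  rw [Polynomial.comp_eq_zero_iff] at h0
  rcases h0 with h0 | ⟨-, h0⟩
  · exact hT (by rw [h0, map_zero])
  · exfalso
    have := congrArg (fun r => Polynomial.coeff r 2) h0
    simp [q, mul_add, ← pow_two, Polynomial.coeff_C] at this

/-- The power sums `α ^ n + β ^ n`, where `α + β = x_i` and `α β = x_j`. -/
def powSum (i j : ℕ) : ℕ → Poly
  | 0 => 0
  | 1 => X i
  | n + 2 => X i * powSum i j (n + 1) + X j * powSum i j n

/-- The power sums `((α + β) α) ^ n + ((α + β) β) ^ n`, where `α + β = x_i` and `α β = x_j`. -/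
def powSumScaled (i j : ℕ) : ℕ → Poly
  | 0 => 0
  | 1 => X i ^ 2
  | 2 => X i ^ 4
  | n + 3 => (X i ^ 2 + X j) * powSumScaled i j (n + 2) + (X i * X j) ^ 2 * powSumScaled i j n

theorem psi_powSum {i j : ℕ} (hij : i ≠ j) :
    ∀ n, psi i j (powSum i j n) = X j ^ n + (X i + X j) ^ n
  | 0 => by simp [powSum, add_self_poly]
  | 1 => by
      simp only [powSum, psi_X, if_neg hij]
      linear_combination -(add_self_poly (X j))
  | n + 2 => by
      simp only [powSum, map_add, map_mul, psi_X, if_neg hij, if_true, psi_powSum hij (n + 1),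
        psi_powSum hij n]
      linear_combination X i * X j ^ (n + 1) * CharTwo.two_eq_zero (R := Poly)

theorem psi_powSumScaled {i j : ℕ} (hij : i ≠ j) :
    ∀ n, psi i j (powSumScaled i j n) = (X i * X j) ^ n + (X i * (X i + X j)) ^ n
  | 0 => by simp [powSumScaled, add_self_poly]
  | 1 => by
      simp only [powSumScaled, map_pow, psi_X, if_neg hij]
      linear_combination - X i * X j * CharTwo.two_eq_zero (R := Poly)
  | 2 => by
      simp only [powSumScaled, map_pow, psi_X, if_neg hij]
      linear_combination - (X i ^ 3 * X j + X i ^ 2 * X j ^ 2) * CharTwo.two_eq_zero (R := Poly)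
  | n + 3 => by
      simp only [powSumScaled, map_add, map_mul, map_pow, psi_X, if_neg hij, if_true,
        psi_powSumScaled hij (n + 2), psi_powSumScaled hij n, pow_add _ n]
      generalize (X i * X j : Poly) ^ n = u
      generalize (X i * (X i + X j) : Poly) ^ n = v
      linear_combination (u * (X i * X j) ^ 2 * (X i ^ 2 + X j ^ 2 + X i * X j) +
        v * (X i * (X i + X j)) ^ 2 * X j ^ 2) * CharTwo.two_eq_zero (R := Poly)

/-- The image of `x_i ^ a x_j ^ b` under the symmetrization operator. -/
def symMon (i j a b : ℕ) : Poly :=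
  if b ≤ a then (X i * X j) ^ b * powSum i j (a - b)
  else (X i * X j) ^ a * powSumScaled i j (b - a)

theorem psi_symMon {i j : ℕ} (hij : i ≠ j) (a b : ℕ) :
    psi i j (symMon i j a b) =
      alphaHom i j (X i ^ a * X j ^ b) + betaHom i j (X i ^ a * X j ^ b) := by
  simp only [symMon, map_mul, map_pow, alphaHom_X, betaHom_X, if_true, if_neg hij.symm]
  split_ifs with h
  · obtain ⟨d, rfl⟩ := Nat.exists_eq_add_of_le h
    simp only [Nat.add_sub_cancel_left, map_mul, map_pow, psi_X, if_true, if_neg hij,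
      psi_powSum hij, mul_pow, add_comm (X j) (X i)]
    ring
  · obtain ⟨d, rfl⟩ := Nat.exists_eq_add_of_le (not_le.1 h).le
    simp only [Nat.add_sub_cancel_left, map_mul, map_pow, psi_X, if_true, if_neg hij,
      psi_powSumScaled hij, mul_pow, add_comm (X j) (X i)]
    ring

/-- The symmetrization operator in the variables `x_i` and `x_j`. -/
def sym (i j : ℕ) : Poly →ₗ[ZMod 2] Poly :=
  (basisMonomials ℕ (ZMod 2)).constr (ZMod 2) fun m =>
    monomial ((m.erase i).erase j) 1 * symMon i j (m i) (m j)

theorem sym_monomial (i j : ℕ) (m : ℕ →₀ ℕ) :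
    sym i j (monomial m 1) = monomial ((m.erase i).erase j) 1 * symMon i j (m i) (m j) := by
  have := (basisMonomials ℕ (ZMod 2)).constr_basis (ZMod 2) (fun m =>
    monomial ((m.erase i).erase j) 1 * symMon i j (m i) (m j)) m
  simpa [sym] using this

theorem monomial_eq_erase_mul {i j : ℕ} (hij : i ≠ j) (m : ℕ →₀ ℕ) :
    (monomial m 1 : Poly) =
      monomial ((m.erase i).erase j) 1 * (X i ^ m i * X j ^ m j) := by
  simp only [X_pow_eq_monomial, monomial_mul, mul_one]
  congr 2
  ext k
  by_cases h1 : k = i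
  · subst h1; simp [hij]
  · by_cases h2 : k = j
    · subst h2; simp [Ne.symm h1]
    · simp [h1, h2]

/-- Polynomials on which the three substitutions agree; the symmetrization operator is linear
over them. -/
def Inv (i j : ℕ) (c : Poly) : Prop :=
  alphaHom i j c = psi i j c ∧ betaHom i j c = psi i j c

theorem Inv.mul {i j : ℕ} {c d : Poly} (hc : Inv i j c) (hd : Inv i j d) :
    Inv i j (c * d) := by
  constructor <;> simp [hc.1, hc.2, hd.1, hd.2]

theorem Inv.one (i j : ℕ) : Inv i j 1 := by
  constructor <;> simp

theorem Inv.pow {i j : ℕ} {c : Poly} (hc : Inv i j c) (n : ℕ) : Inv i j (c ^ n) := by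
  constructor <;> simp [hc.1, hc.2]

theorem Inv.X {i j k : ℕ} (hi : k ≠ i) (hj : k ≠ j) : Inv i j (X k) := by
  constructor <;> simp [hi, hj]

theorem Inv.X_mul_X {i j : ℕ} (hij : i ≠ j) : Inv i j (MvPolynomial.X i * MvPolynomial.X j) := by
  constructor <;> simp [hij, hij.symm] <;> ring

theorem Inv.monomial {i j : ℕ} {m : ℕ →₀ ℕ} (hi : m i = 0) (hj : m j = 0) :
    Inv i j (monomial m 1) := by
  rw [monomial_eq, map_one, one_mul]
  refine Finset.prod_induction _ (Inv i j) (fun _ _ => Inv.mul) (Inv.one i j) fun k hk => ?_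
  refine (Inv.X ?_ ?_).pow _
  · rintro rfl; simp [hi] at hk
  · rintro rfl; simp [hj] at hk

theorem psi_sym {i j : ℕ} (hij : i ≠ j) (p : Poly) :
    psi i j (sym i j p) = alphaHom i j p + betaHom i j p := by
  have : (psi i j).toLinearMap ∘ₗ sym i j =
      (alphaHom i j).toLinearMap + (betaHom i j).toLinearMap := by
    refine (basisMonomials ℕ (ZMod 2)).ext fun m => ?_
    have h : Inv i j (MvPolynomial.monomial ((m.erase i).erase j) 1) :=
      Inv.monomial (by by_cases h : i = j <;> simp [h]) (by simp)
    simp only [coe_basisMonomials, LinearMap.comp_apply, AlgHom.toLinearMap_apply,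
      LinearMap.add_apply, sym_monomial, map_mul, psi_symMon hij]
    rw [monomial_eq_erase_mul hij m, map_mul (alphaHom i j) (MvPolynomial.monomial _ _),
      map_mul (betaHom i j) (MvPolynomial.monomial _ _), h.1, h.2, ← mul_add, map_mul, map_mul]
  exact congrArg (fun f => f p) this

theorem sym_mul {i j : ℕ} (hij : i ≠ j) {c : Poly} (hc : Inv i j c) (p : Poly) :
    sym i j (c * p) = c * sym i j p := by
  apply psi_injective hij
  rw [psi_sym hij, map_mul, map_mul, map_mul, psi_sym hij, hc.1, hc.2, mul_add]

/-- The linear substitution `x_i ↦ x_j + e x_i`, `x_j ↦ x_i`. -/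
def twist (i j : ℕ) (e : ZMod 2) : Poly →ₐ[ZMod 2] Poly :=
  aeval fun k => if k = i then X j + C e * X i else if k = j then X i else X k

@[simp] theorem twist_X (i j : ℕ) (e : ZMod 2) (k : ℕ) :
    twist i j e (X k) = if k = i then X j + C e * X i else if k = j then X i else X k := by
  simp [twist]

theorem algHom_congr {f g : Poly →ₐ[ZMod 2] Poly} (h : ∀ n, f (X n) = g (X n)) (p : Poly) :
    f p = g p := by
  rw [MvPolynomial.algHom_ext (f := f) (g := g) h]

theorem twist_zero_psi {i j : ℕ} (hij : i ≠ j) (p : Poly) :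
    twist i j 0 (psi i j p) = alphaHom i j p := by
  refine algHom_congr (f := (twist i j 0).comp (psi i j)) (fun n => ?_) p
  by_cases h1 : n = i
  · simp [h1, hij]
  by_cases h2 : n = j <;> simp [h1, h2, hij.symm]

theorem twist_one_psi {i j : ℕ} (hij : i ≠ j) (p : Poly) :
    twist i j 1 (psi i j p) = betaHom i j p := by
  refine algHom_congr (f := (twist i j 1).comp (psi i j)) (fun n => ?_) p
  by_cases h1 : n = i
  · simp [h1, hij, add_comm]
  by_cases h2 : n = j
  · simp [h2, hij.symm]
    linear_combination X i * CharTwo.two_eq_zero (R := Poly)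
  · simp [h1, h2]

theorem twist_zero_alphaHom {i j : ℕ} (hij : i ≠ j) (p : Poly) :
    twist i j 0 (alphaHom i j p) = twist i j 1 (alphaHom i j p) := by
  refine algHom_congr (f := (twist i j 0).comp (alphaHom i j))
    (g := (twist i j 1).comp (alphaHom i j)) (fun n => ?_) p
  by_cases h1 : n = i
  · simp [h1, hij.symm]
  by_cases h2 : n = j
  · simp [h2, hij.symm]
    linear_combination - (X i * X j + X i * X i) * CharTwo.two_eq_zero (R := Poly)
  · simp [h1, h2]

theorem twist_zero_betaHom {i j : ℕ} (hij : i ≠ j) (p : Poly) :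
    twist i j 0 (betaHom i j p) = betaHom i j p := by
  refine algHom_congr (f := (twist i j 0).comp (betaHom i j)) (fun n => ?_) p
  by_cases h1 : n = i
  · simp [h1, hij.symm, add_comm]
  by_cases h2 : n = j <;> simp [h1, h2, hij.symm, mul_comm]

theorem twist_one_betaHom {i j : ℕ} (hij : i ≠ j) (p : Poly) :
    twist i j 1 (betaHom i j p) = alphaHom i j p := by
  refine algHom_congr (f := (twist i j 1).comp (betaHom i j)) (fun n => ?_) p
  by_cases h1 : n = i
  · simp [h1, hij.symm]
    linear_combination X i * CharTwo.two_eq_zero (R := Poly)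
  by_cases h2 : n = j
  · simp [h2, hij.symm]
    ring
  · simp [h1, h2]

theorem sym_idem {i j : ℕ} (hij : i ≠ j) (p : Poly) :
    sym i j (sym i j p) = sym i j p := by
  apply psi_injective hij
  rw [psi_sym hij, ← twist_zero_psi hij, ← twist_one_psi hij, psi_sym hij, map_add, map_add,
    twist_zero_alphaHom hij, twist_zero_betaHom hij, twist_one_betaHom hij]
  linear_combination add_self_poly (twist i j 1 (alphaHom i j p))

theorem Inv.add {i j : ℕ} {c d : Poly} (hc : Inv i j c) (hd : Inv i j d) :
    Inv i j (c + d) := by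
  constructor <;> simp [hc.1, hc.2, hd.1, hd.2]

theorem Inv.zero (i j : ℕ) : Inv i j 0 := by
  constructor <;> simp

theorem Inv.powSum {i j k l : ℕ} (hk : Inv i j (MvPolynomial.X k))
    (hl : Inv i j (MvPolynomial.X l)) : ∀ n, Inv i j (powSum k l n)
  | 0 => Inv.zero i j
  | 1 => hk
  | n + 2 => (hk.mul (Inv.powSum hk hl (n + 1))).add (hl.mul (Inv.powSum hk hl n))

theorem Inv.powSumScaled {i j k l : ℕ} (hk : Inv i j (MvPolynomial.X k))
    (hl : Inv i j (MvPolynomial.X l)) : ∀ n, Inv i j (powSumScaled k l n)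
  | 0 => Inv.zero i j
  | 1 => hk.pow 2
  | 2 => hk.pow 4
  | n + 3 => (((hk.pow 2).add hl).mul (Inv.powSumScaled hk hl (n + 2))).add
      (((hk.mul hl).pow 2).mul (Inv.powSumScaled hk hl n))

theorem Inv.symMon {i j k l : ℕ} (hk : Inv i j (MvPolynomial.X k))
    (hl : Inv i j (MvPolynomial.X l)) (a b : ℕ) : Inv i j (symMon k l a b) := by
  unfold Behrens.symMon
  split_ifs
  · exact ((hk.mul hl).pow _).mul (Inv.powSum hk hl _)
  · exact ((hk.mul hl).pow _).mul (Inv.powSumScaled hk hl _)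

theorem sym_sym_monomial {i j k l : ℕ} (hij : i ≠ j) (hik : i ≠ k) (hil : i ≠ l)
    (hjk : j ≠ k) (hjl : j ≠ l) (m : ℕ →₀ ℕ) :
    sym i j (sym k l (monomial m 1)) =
      monomial ((((m.erase k).erase l).erase i).erase j) 1 *
        (symMon i j (m i) (m j) * symMon k l (m k) (m l)) := by
  rw [sym_monomial, mul_comm, sym_mul hij (Inv.symMon (Inv.X hik.symm hjk.symm)
    (Inv.X hil.symm hjl.symm) _ _), sym_monomial]
  simp only [Finsupp.erase_ne hik, Finsupp.erase_ne hil, Finsupp.erase_ne hjk,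
    Finsupp.erase_ne hjl]
  ring

theorem sym_comm {i j k l : ℕ} (hij : i ≠ j) (hkl : k ≠ l) (hik : i ≠ k) (hil : i ≠ l)
    (hjk : j ≠ k) (hjl : j ≠ l) (p : Poly) :
    sym i j (sym k l p) = sym k l (sym i j p) := by
  have : sym i j ∘ₗ sym k l = sym k l ∘ₗ sym i j := by
    refine (basisMonomials ℕ (ZMod 2)).ext fun m => ?_
    simp only [coe_basisMonomials, LinearMap.comp_apply]
    rw [sym_sym_monomial hij hik hil hjk hjl, sym_sym_monomial hkl hik.symm hjk.symm hil.symm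
      hjl.symm, mul_comm (symMon i j _ _)]
    congr 3
    ext n
    simp only [Finsupp.erase_apply]
    split_ifs <;> rfl
  exact congrArg (fun f => f p) this

/-- The substitution sending `x_i, x_j, x_k` to the upper triangular invariants of the
three variables. -/
def triHom (i j k : ℕ) : Poly →ₐ[ZMod 2] Poly :=
  (psi i k).comp ((psi i j).comp (psi j k))

theorem triHom_injective {i j k : ℕ} (hij : i ≠ j) (hik : i ≠ k) (hjk : j ≠ k) :
    Function.Injective (triHom i j k) := by
  simpa [triHom] using (psi_injective hik).comp ((psi_injective hij).comp (psi_injective hjk))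

/-- The substitution of `x_k` by the top upper triangular invariant. -/
def topHom (i j k : ℕ) : Poly →ₐ[ZMod 2] Poly :=
  aeval fun n => if n = k then
    X k * (X k + X i) * (X k * (X k + X i) + X j * (X j + X i)) else X n

@[simp] theorem topHom_X (i j k n : ℕ) : topHom i j k (X n) = if n = k then
    X k * (X k + X i) * (X k * (X k + X i) + X j * (X j + X i)) else X n := by
  simp [topHom]

theorem topHom_psi {i j k : ℕ} (hij : i ≠ j) (hik : i ≠ k) (hjk : j ≠ k) (p : Poly) :
    topHom i j k (psi i j p) = triHom i j k p := by
  refine algHom_congr (f := (topHom i j k).comp (psi i j)) (fun n => ?_) p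
  by_cases h1 : n = i
  · simp [h1, hij, hik, triHom]
  by_cases h2 : n = j
  · simp [h2, hik, hjk, triHom]
  by_cases h3 : n = k
  · simp [h3, hik, hjk.symm, hjk, triHom]
  · simp [h2, h3, triHom]

theorem topHom_alphaHom {i j k : ℕ} (hij : i ≠ j) (hik : i ≠ k) (hjk : j ≠ k) (p : Poly) :
    topHom i j k (alphaHom i j p) = twist i j 0 (triHom i j k p) := by
  refine algHom_congr (f := (topHom i j k).comp (alphaHom i j))
    (g := (twist i j 0).comp (triHom i j k)) (fun n => ?_) p
  by_cases h1 : n = i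
  · simp [h1, hij, hik, hjk, triHom]
  by_cases h2 : n = j
  · simp [h2, hij.symm, hik, hjk, triHom]
  by_cases h3 : n = k
  · simp [h3, hij.symm, hik, hik.symm, hjk.symm, hjk, triHom]
    grind
  · simp [h1, h2, h3, triHom]

theorem topHom_betaHom {i j k : ℕ} (hij : i ≠ j) (hik : i ≠ k) (hjk : j ≠ k) (p : Poly) :
    topHom i j k (betaHom i j p) = twist i j 1 (triHom i j k p) := by
  refine algHom_congr (f := (topHom i j k).comp (betaHom i j))
    (g := (twist i j 1).comp (triHom i j k)) (fun n => ?_) p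
  by_cases h1 : n = i
  · simp [h1, hij, hik, hjk, triHom, add_comm]
  by_cases h2 : n = j
  · simp [h2, hij.symm, hik, hjk, triHom]
    grind
  by_cases h3 : n = k
  · simp [h3, hij.symm, hik, hik.symm, hjk.symm, hjk, triHom]
    grind
  · simp [h1, h2, h3, triHom]

theorem psi_psi_alphaHom {i j k : ℕ} (hij : i ≠ j) (hik : i ≠ k) (hjk : j ≠ k) (p : Poly) :
    psi i k (psi i j (alphaHom j k p)) = twist j k 0 (triHom i j k p) := by
  refine algHom_congr (f := (psi i k).comp ((psi i j).comp (alphaHom j k)))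
    (g := (twist j k 0).comp (triHom i j k)) (fun n => ?_) p
  by_cases h1 : n = i
  · simp [h1, hij, hik, triHom]
  by_cases h2 : n = j
  · simp [h2, hij, hik, hjk, hjk.symm, triHom]
  by_cases h3 : n = k
  · simp [h3, hij, hik, hjk.symm, hjk, triHom]
  · simp [h2, h3, triHom]

theorem psi_psi_betaHom {i j k : ℕ} (hij : i ≠ j) (hik : i ≠ k) (hjk : j ≠ k) (p : Poly) :
    psi i k (psi i j (betaHom j k p)) = twist j k 1 (triHom i j k p) := by
  refine algHom_congr (f := (psi i k).comp ((psi i j).comp (betaHom j k)))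
    (g := (twist j k 1).comp (triHom i j k)) (fun n => ?_) p
  by_cases h1 : n = i
  · simp [h1, hij, hik, triHom]
  by_cases h2 : n = j
  · simp [h2, hij, hik, hjk, hjk.symm, triHom]
    grind
  by_cases h3 : n = k
  · simp [h3, hij, hik, hjk.symm, hjk, triHom]
    grind
  · simp [h2, h3, triHom]

theorem triHom_sym_left {i j k : ℕ} (hij : i ≠ j) (hik : i ≠ k) (hjk : j ≠ k) (p : Poly) :
    triHom i j k (sym i j p) =
      twist i j 0 (triHom i j k p) + twist i j 1 (triHom i j k p) := by
  rw [← topHom_psi hij hik hjk, psi_sym hij, map_add, topHom_alphaHom hij hik hjk,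
    topHom_betaHom hij hik hjk]

theorem triHom_sym_right {i j k : ℕ} (hij : i ≠ j) (hik : i ≠ k) (hjk : j ≠ k) (p : Poly) :
    triHom i j k (sym j k p) =
      twist j k 0 (triHom i j k p) + twist j k 1 (triHom i j k p) := by
  rw [← psi_psi_alphaHom hij hik hjk, ← psi_psi_betaHom hij hik hjk, ← map_add, ← map_add,
    ← psi_sym hjk]
  rfl

theorem twist_braid {i j k : ℕ} (hij : i ≠ j) (hik : i ≠ k) (hjk : j ≠ k) (a b c : ZMod 2)
    (p : Poly) : twist i j a (twist j k b (twist i j c p)) =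
      twist j k c (twist i j (b + c * a) (twist j k a p)) := by
  refine algHom_congr (f := (twist i j a).comp ((twist j k b).comp (twist i j c)))
    (g := (twist j k c).comp ((twist i j (b + c * a)).comp (twist j k a))) (fun n => ?_) p
  have hC (e : ZMod 2) (u v) : twist u v e (C a) = C a := (twist u v e).commutes a
  have hC' (e : ZMod 2) (u v) : twist u v e (C c) = C c := (twist u v e).commutes c
  have hC'' (e : ZMod 2) (u v) : twist u v e (C b) = C b := (twist u v e).commutes b
  by_cases h1 : n = i
  · simp [h1, hij, hij.symm, hik, hik.symm, hjk.symm, hC, hC', hC'']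
    ring
  by_cases h2 : n = j
  · simp [h2, hij, hij.symm, hik, hik.symm, hjk.symm, hC]
  by_cases h3 : n = k
  · simp [h3, hij, hij.symm, hik, hik.symm, hjk.symm]
  · simp [h1, h2, h3]

theorem sym_braid {i j k : ℕ} (hij : i ≠ j) (hik : i ≠ k) (hjk : j ≠ k) (p : Poly) :
    sym i j (sym j k (sym i j p)) = sym j k (sym i j (sym j k p)) := by
  apply triHom_injective hij hik hjk
  have h11 : (1 + 1 : ZMod 2) = 0 := rfl
  simp only [triHom_sym_left hij hik hjk, triHom_sym_right hij hik hjk, map_add,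
    twist_braid hij hik hjk, mul_zero, mul_one, zero_add, add_zero, h11]
  abel

/-- Generalized binomial coefficients modulo two. -/
def ch (x : ℤ) (n : ℕ) : ZMod 2 := ((Ring.choose x n : ℤ) : ZMod 2)

theorem ch_zero (x : ℤ) : ch x 0 = 1 := by simp [ch]

theorem ch_succ (x : ℤ) (n : ℕ) : ch (x + 1) (n + 1) = ch x n + ch x (n + 1) := by
  simp [ch, Ring.choose_succ_succ]

theorem ch_natCast (m n : ℕ) : ch m n = (m.choose n : ZMod 2) := by
  simp [ch, Ring.choose_natCast]

theorem ch_neg (x : ℤ) (n : ℕ) : ch (-x) n = ch (x + n - 1) n := by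
  have : ∀ u : ℤ, (-u : ZMod 2) = u := fun u => ZMod.neg_eq_self_mod_two _
  rw [ch, ch, Ring.choose_neg]
  rcases Int.even_or_odd n with h | h
  · simp [Int.negOnePow_even _ h]
  · simp [Int.negOnePow_odd _ h, this]

theorem ch_diagonal (k : ℕ) : ch (-1 - (k + 1 : ℕ)) (k + 1) = 0 := by
  have h : (-1 - ((k + 1 : ℕ) : ℤ)) = -((k + 2 : ℕ) : ℤ) := by push_cast; ring
  rw [h, ch_neg]
  have h : ((k + 2 : ℕ) : ℤ) + ((k + 1 : ℕ) : ℤ) - 1 = ((2 * (k + 1) : ℕ) : ℤ) := by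
    push_cast; ring
  rw [h, ch_natCast, ← Nat.centralBinom_eq_two_mul_choose]
  exact (ZMod.natCast_eq_zero_iff _ _).2 (Nat.two_dvd_centralBinom_succ k)

theorem sum_ch_mul_ch (n : ℕ) : ∀ x y : ℤ,
    ∑ k ∈ Finset.range (n + 1), ch (x - k) k * ch (y + k) (n - k) = ch (x + y + 1) n := by
  induction n with
  | zero => intro x y; simp [ch_zero]
  | succ n ih =>
    intro x y
    have step : ∀ x : ℤ,
        ∑ k ∈ Finset.range (n + 2), ch (x + 1 - k) k * ch (y + k) (n + 1 - k) =
        ∑ k ∈ Finset.range (n + 2), ch (x - k) k * ch (y + k) (n + 1 - k) +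
          ch (x + y + 1) n := by
      intro x
      have := ih (x - 1) (y + 1)
      rw [show x - 1 + (y + 1) + 1 = x + y + 1 by ring] at this
      rw [← this, Finset.sum_range_succ', Finset.sum_range_succ' _ (n + 1), add_right_comm,
        ← Finset.sum_add_distrib]
      congr 1
      · refine Finset.sum_congr rfl fun k _ => ?_
        rw [show x + 1 - ((k + 1 : ℕ) : ℤ) = (x - ((k + 1 : ℕ) : ℤ)) + 1 by ring, ch_succ,
          show n + 1 - (k + 1) = n - k by omega,
          show x - ((k + 1 : ℕ) : ℤ) = x - 1 - k by push_cast; ring,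
          show y + ((k + 1 : ℕ) : ℤ) = y + 1 + k by push_cast; ring]
        ring
      · simp [ch_zero]
    have succ_eq : ∀ x : ℤ, ch (x + 1 + y + 1) (n + 1) =
        ch (x + y + 1) (n + 1) + ch (x + y + 1) n := by
      intro x
      rw [show x + 1 + y + 1 = (x + y + 1) + 1 by ring, ch_succ, add_comm]
    induction x using Int.inductionOn' (b := -1) with
    | zero =>
      rw [Finset.sum_range_succ', Finset.sum_eq_zero]
      · simp [ch_zero]
      · intro k _
        rw [ch_diagonal, zero_mul]
    | succ x _ hx => rw [step, hx, succ_eq]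
    | pred x _ hx =>
      have h1 := step (x - 1)
      have h2 := succ_eq (x - 1)
      rw [sub_add_cancel] at h1 h2
      rw [h1, h2] at hx
      exact add_right_cancel hx

theorem sum_choose_mul_choose {M B : ℕ} (h : M < B) :
    ∑ k ∈ Finset.range (M + 1),
      ((M + B - 2 * k).choose (B - k) : ZMod 2) * ((M + 2 * B - k).choose k : ZMod 2) =
      ((M + B).choose B : ZMod 2) := by
  have := sum_ch_mul_ch M (M + 2 * B : ℕ) (-(B + 1 : ℕ))
  rw [show ((M + 2 * B : ℕ) : ℤ) + -((B + 1 : ℕ) : ℤ) + 1 = ((M + B : ℕ) : ℤ) by push_cast; ring,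
    ch_natCast, Nat.choose_symm_add] at this
  rw [← this]
  refine Finset.sum_congr rfl fun k hk => ?_
  have hk : k ≤ M := Nat.lt_succ_iff.1 (Finset.mem_range.1 hk)
  rw [← Nat.cast_sub (by omega), ch_natCast,
    show -((B + 1 : ℕ) : ℤ) + (k : ℤ) = -((B + 1 - k : ℕ) : ℤ) by omega, ch_neg,
    show ((B + 1 - k : ℕ) : ℤ) + ((M - k : ℕ) : ℤ) - 1 = ((M + B - 2 * k : ℕ) : ℤ) by omega,
    ch_natCast, mul_comm, Nat.choose_symm_of_eq_add (show M + B - 2 * k = (B - k) + (M - k) by omega)]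

/-- The Behrens relation for the family of coefficients of `x_i * powSum i j (n + 1)`. -/
theorem sum_behrensCoeff_mul_choose {a b n y : ℕ} (hab : a ≤ b + 1)
    (h : a + 2 * b = n + 2 + 3 * y) :
    (∑ c ∈ Finset.range (a + 2 * b), if 3 * c + 1 < a + 2 * b then
      behrensCoeff a b c * (if y ≤ c then ((n - (c - y)).choose (c - y) : ZMod 2) else 0)
      else 0) = if y ≤ b then ((n - (b - y)).choose (b - y) : ZMod 2) else 0 := by
  have hyb : y ≤ b := by omega
  obtain ⟨B, rfl⟩ := Nat.exists_eq_add_of_le hyb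
  rw [if_pos hyb, Nat.add_sub_cancel_left]
  rcases lt_or_ge n (2 * B) with hn | hn
  · rw [Nat.choose_eq_zero_of_lt (by omega), Nat.cast_zero]
    refine Finset.sum_eq_zero fun c _ => ?_
    split_ifs with h1 h2
    · unfold behrensCoeff
      split_ifs with h3
      · rw [Nat.choose_eq_zero_of_lt (by omega), Nat.cast_zero, zero_mul]
      · rw [zero_mul]
    · rw [mul_zero]
    · rfl
  · obtain ⟨M, rfl⟩ := Nat.exists_eq_add_of_le hn
    have hM : M < B := by omega
    rw [show 2 * B + M - B = M + B by omega, ← sum_choose_mul_choose hM]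
    symm
    refine Finset.sum_of_injOn (fun k => k + y) (fun _ _ _ _ => by simp) ?_ ?_ ?_
    · intro k hk
      simp only [Finset.coe_range, Set.mem_Iio] at hk ⊢
      omega
    · intro c _ hc
      split_ifs with h1 h2
      · obtain ⟨C, rfl⟩ := Nat.exists_eq_add_of_le h2
        have : M + 1 ≤ C := by
          by_contra hC
          exact hc ⟨C, by simpa using hC, add_comm _ _⟩
        unfold behrensCoeff
        split_ifs with h3
        · rw [Nat.choose_eq_zero_of_lt (by omega), Nat.cast_zero, zero_mul]
        · rw [zero_mul]
      · rw [mul_zero]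
      · rfl
    · intro k hk
      have hk := Finset.mem_range.1 hk
      rw [if_pos (by omega), if_pos (by omega), behrensCoeff, if_pos (by omega),
        Nat.add_sub_cancel, show a + (y + B) - 2 * (k + y) - 2 = M + B - 2 * k by omega,
        show y + B - (k + y) = B - k by omega, show 2 * B + M = M + 2 * B by omega]

/-- The polynomials whose coefficients satisfy the Behrens relations in the exponents of
`x_i` and `x_j`. -/
def relSubmodule (i j : ℕ) : Submodule (ZMod 2) Poly where
  carrier := {f | ∀ (r : ℕ →₀ ℕ) (a b : ℕ), r i = 0 → r j = 0 → a ≤ b + 1 →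
    (∑ c ∈ Finset.range (a + 2 * b), if 3 * c + 1 < a + 2 * b then behrensCoeff a b c *
      coeff (r + Finsupp.single i (a + 2 * b - 2 * c) + Finsupp.single j c) f else 0) =
    coeff (r + Finsupp.single i a + Finsupp.single j b) f}
  add_mem' := by
    intro f g hf hg r a b hi hj hab
    rw [coeff_add, ← hf r a b hi hj hab, ← hg r a b hi hj hab, ← Finset.sum_add_distrib]
    refine Finset.sum_congr rfl fun c _ => ?_
    split_ifs
    · rw [coeff_add, mul_add]
    · rw [add_zero]
  zero_mem' := by
    intro r a b _ _ _
    simp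
  smul_mem' := by
    intro t f hf r a b hi hj hab
    rw [coeff_smul, ← hf r a b hi hj hab, Finset.smul_sum]
    refine Finset.sum_congr rfl fun c _ => ?_
    split_ifs
    · rw [coeff_smul, smul_eq_mul, smul_eq_mul, mul_left_comm]
    · rw [smul_zero]

theorem coeff_powSum {i j : ℕ} (hij : i ≠ j) : ∀ (n : ℕ) (r : ℕ →₀ ℕ) (a b : ℕ), r i = 0 →
    r j = 0 → coeff (r + Finsupp.single i a + Finsupp.single j b) (powSum i j n) =
      if r = 0 ∧ a + 2 * b = n ∧ 0 < n then ((a + b - 1).choose b : ZMod 2) else 0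
  | 0 => by simp [powSum]
  | 1 => by
      intro r a b hi hj
      rw [powSum, coeff_X]
      by_cases h : r = 0 ∧ a = 1 ∧ b = 0
      · obtain ⟨rfl, rfl, rfl⟩ := h
        simp
      · rw [if_neg, if_neg]
        · rintro ⟨h1, h2, -⟩
          exact h ⟨h1, by omega, by omega⟩
        · intro h0
          have hi' := DFunLike.congr_fun h0 i
          have hj' := DFunLike.congr_fun h0 j
          simp [hi, hj, hij, hij.symm] at hi' hj'
          subst hi' hj'
          exact h ⟨by simpa using h0.symm, rfl, rfl⟩
  | n + 2 => by
      intro r a b hi hj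
      have e1 : coeff (r + Finsupp.single i a + Finsupp.single j b) (X i * powSum i j (n + 1)) =
          if 0 < a then coeff (r + Finsupp.single i (a - 1) + Finsupp.single j b)
            (powSum i j (n + 1)) else 0 := by
        rcases a with _ | a
        · rw [coeff_X_mul']
          simp [hi, hij]
        · rw [if_pos (Nat.succ_pos a), Nat.add_sub_cancel, Finsupp.single_add,
            show r + (Finsupp.single i a + Finsupp.single i 1) + Finsupp.single j b =
            Finsupp.single i 1 + (r + Finsupp.single i a + Finsupp.single j b) by abel,
            coeff_X_mul]
      have e2 : coeff (r + Finsupp.single i a + Finsupp.single j b) (X j * powSum i j n) =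
          if 0 < b then coeff (r + Finsupp.single i a + Finsupp.single j (b - 1))
            (powSum i j n) else 0 := by
        rcases b with _ | b
        · rw [coeff_X_mul']
          simp [hj, hij.symm]
        · rw [if_pos (Nat.succ_pos b), Nat.add_sub_cancel, Finsupp.single_add,
            show r + Finsupp.single i a + (Finsupp.single j b + Finsupp.single j 1) =
            Finsupp.single j 1 + (r + Finsupp.single i a + Finsupp.single j b) by abel,
            coeff_X_mul]
      rw [powSum, coeff_add, e1, e2, coeff_powSum hij (n + 1) r _ _ hi hj,
        coeff_powSum hij n r _ _ hi hj]
      by_cases hr : r = 0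
      swap
      · simp [hr]
      by_cases hn : a + 2 * b = n + 2
      swap
      · rw [if_neg (c := r = 0 ∧ a + 2 * b = n + 2 ∧ _) (by omega)]
        split_ifs <;> first | omega | simp
      rw [if_pos (c := r = 0 ∧ a + 2 * b = n + 2 ∧ _) ⟨hr, hn, by omega⟩]
      rcases a with _ | a
      · rcases b with _ | b
        · omega
        · rw [if_neg (by omega), if_pos (by omega), zero_add,
            Nat.choose_eq_zero_of_lt (by omega : 0 + (b + 1) - 1 < b + 1), Nat.cast_zero]
          split_ifs with h
          · rw [Nat.choose_eq_zero_of_lt (by omega), Nat.cast_zero]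
          · rfl
      · rw [if_pos (by omega), if_pos ⟨hr, by omega, by omega⟩]
        rcases b with _ | b
        · simp
        · rw [if_pos (by omega)]
          rcases Nat.eq_zero_or_pos n with rfl | hn0
          · omega
          · rw [if_pos ⟨hr, by omega, hn0⟩,
              show a + 1 + (b + 1) - 1 = a + b + 1 by omega, Nat.choose_succ_succ,
              show a + 1 - 1 + (b + 1) - 1 = a + b by omega,
              show a + 1 + (b + 1 - 1) - 1 = a + b by omega, Nat.add_sub_cancel, Nat.cast_add,
              add_comm]

theorem coeff_monomial_mul_powSum {i j : ℕ} (hij : i ≠ j) {μ : ℕ →₀ ℕ} (hμi : μ i = 0)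
    (hμj : μ j = 0) (y n : ℕ) {r : ℕ →₀ ℕ} {a b : ℕ} (hi : r i = 0) (hj : r j = 0) :
    coeff (r + Finsupp.single i a + Finsupp.single j b)
      (monomial (μ + Finsupp.single i (y + 1) + Finsupp.single j y) 1 * powSum i j (n + 1)) =
      if r = μ ∧ a + 2 * b = n + 2 + 3 * y then
        (if y ≤ b then ((n - (b - y)).choose (b - y) : ZMod 2) else 0) else 0 := by
  have hle : μ + Finsupp.single i (y + 1) + Finsupp.single j y ≤
      r + Finsupp.single i a + Finsupp.single j b ↔ μ ≤ r ∧ y + 1 ≤ a ∧ y ≤ b := by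
    constructor
    · intro h
      refine ⟨fun k => ?_, ?_, ?_⟩
      · have := h k
        by_cases h1 : k = i
        · simp [h1, hμi]
        by_cases h2 : k = j
        · simp [h2, hμj]
        simpa [Finsupp.single_apply, Ne.symm h1, Ne.symm h2] using this
      · simpa [hi, hμi, hij, hij.symm] using h i
      · simpa [hj, hμj, hij, hij.symm] using h j
    · rintro ⟨h1, h2, h3⟩
      gcongr
  rw [coeff_monomial_mul', one_mul]
  simp only [hle]
  by_cases h : μ ≤ r ∧ y + 1 ≤ a ∧ y ≤ b
  · obtain ⟨h1, h2, h3⟩ := h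
    rw [if_pos ⟨h1, h2, h3⟩, if_pos h3]
    obtain ⟨s, rfl⟩ := exists_add_of_le h1
    obtain ⟨A, rfl⟩ := exists_add_of_le h2
    obtain ⟨B, rfl⟩ := exists_add_of_le h3
    have : μ + s + Finsupp.single i (y + 1 + A) + Finsupp.single j (y + B) -
        (μ + Finsupp.single i (y + 1) + Finsupp.single j y) =
        s + Finsupp.single i A + Finsupp.single j B := by
      rw [Finsupp.single_add i (y + 1) A, Finsupp.single_add j y B]
      rw [show μ + s + (Finsupp.single i (y + 1) + Finsupp.single i A) +
        (Finsupp.single j y + Finsupp.single j B) =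
        (μ + Finsupp.single i (y + 1) + Finsupp.single j y) +
        (s + Finsupp.single i A + Finsupp.single j B) by abel, add_tsub_cancel_left]
    rw [this, coeff_powSum hij _ _ _ _ (by simpa [hμi] using hi) (by simpa [hμj] using hj),
      Nat.add_sub_cancel_left]
    simp only [add_eq_left]
    by_cases hs : s = 0 ∧ A + 2 * B = n + 1
    · rw [if_pos ⟨hs.1, hs.2, by omega⟩, if_pos ⟨hs.1, by omega⟩,
        show n - B = A + B - 1 by omega]
    · rw [if_neg (by tauto), if_neg]
      rintro ⟨h, h'⟩
      exact hs ⟨h, by omega⟩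
  · rw [if_neg h]
    split_ifs with h1 h2
    · rw [Nat.choose_eq_zero_of_lt, Nat.cast_zero]
      have : ¬ y + 1 ≤ a := fun h3 => h ⟨h1.1 ▸ le_rfl, h3, h2⟩
      omega
    · rfl
    · rfl

theorem monomial_mul_powSum_mem {i j : ℕ} (hij : i ≠ j) {μ : ℕ →₀ ℕ} (hμi : μ i = 0)
    (hμj : μ j = 0) (y n : ℕ) :
    X i * (monomial μ 1 * ((X i * X j) ^ y * powSum i j n)) ∈ relSubmodule i j := by
  rcases n with _ | n
  · simp [powSum]
  have : X i * (monomial μ 1 * ((X i * X j) ^ y * powSum i j (n + 1))) =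
      monomial (μ + Finsupp.single i (y + 1) + Finsupp.single j y) 1 * powSum i j (n + 1) := by
    have : (monomial (μ + Finsupp.single i (y + 1) + Finsupp.single j y) 1 : Poly) =
        monomial μ 1 * X i ^ (y + 1) * X j ^ y := by
      simp [X_pow_eq_monomial, monomial_mul]
    rw [this]
    ring
  rw [this]
  intro r a b hi hj hab
  simp only [coeff_monomial_mul_powSum hij hμi hμj y n hi hj]
  by_cases h : r = μ ∧ a + 2 * b = n + 2 + 3 * y
  · rw [if_pos h, ← sum_behrensCoeff_mul_choose hab h.2]
    refine Finset.sum_congr rfl fun c _ => ?_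
    split_ifs with h1 h2 <;> first | rfl | exact absurd ⟨h.1, by omega⟩ h2
  · rw [if_neg h]
    refine Finset.sum_eq_zero fun c _ => ?_
    split_ifs with h1 h2 <;> first | rfl | simp
    all_goals exact absurd ⟨h2.1, by omega⟩ h

/-- The span of the polynomials `(x_i x_j) ^ y * powSum i j n`. -/
def powSumSpan (i j : ℕ) : Submodule (ZMod 2) Poly :=
  Submodule.span (ZMod 2) (Set.range fun t : ℕ × ℕ => (X i * X j) ^ t.1 * powSum i j t.2)

theorem mul_powSumSpan {i j : ℕ} (z : Poly)
    (hz : ∀ y n, z * ((X i * X j) ^ y * powSum i j n) ∈ powSumSpan i j) {f : Poly}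
    (hf : f ∈ powSumSpan i j) : z * f ∈ powSumSpan i j := by
  induction hf using Submodule.span_induction with
  | mem f h => obtain ⟨t, rfl⟩ := h; exact hz _ _
  | zero => rw [mul_zero]; exact zero_mem _
  | add f g _ _ hf hg => rw [mul_add]; exact add_mem hf hg
  | smul a f _ hf => rw [mul_smul_comm]; exact Submodule.smul_mem _ _ hf

theorem pow_mul_powSum_mem (i j y n : ℕ) :
    (X i * X j) ^ y * powSum i j n ∈ powSumSpan i j :=
  Submodule.subset_span ⟨(y, n), rfl⟩

theorem pow_mul_mem_powSumSpan {i j : ℕ} (y : ℕ) {f : Poly} (hf : f ∈ powSumSpan i j) :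
    (X i * X j) ^ y * f ∈ powSumSpan i j := by
  refine mul_powSumSpan _ (fun y' n => ?_) hf
  rw [← mul_assoc, ← pow_add]
  exact pow_mul_powSum_mem _ _ _ _

theorem quadratic_mul_mem_powSumSpan {i j : ℕ} {f : Poly} (hf : f ∈ powSumSpan i j) :
    (X i ^ 2 + X j) * f ∈ powSumSpan i j := by
  refine mul_powSumSpan _ (fun y n => ?_) hf
  rcases n with _ | n
  · simp [powSum]
  · have : (X i ^ 2 + X j) * ((X i * X j) ^ y * powSum i j (n + 1)) =
        (X i * X j) ^ y * powSum i j (n + 3) + (X i * X j) ^ (y + 1) * powSum i j n := by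
      rw [powSum, powSum]
      linear_combination - (X i * X j) ^ (y + 1) * powSum i j n * CharTwo.two_eq_zero (R := Poly)
    rw [this]
    exact add_mem (pow_mul_powSum_mem _ _ _ _) (pow_mul_powSum_mem _ _ _ _)

theorem powSumScaled_mem (i j : ℕ) : ∀ n, powSumScaled i j n ∈ powSumSpan i j
  | 0 => zero_mem _
  | 1 => by
      have := pow_mul_powSum_mem i j 0 2
      simpa [powSum, powSumScaled, pow_two] using this
  | 2 => by
      have : powSumScaled i j 2 = powSum i j 4 := by
        simp only [powSum, powSumScaled]
        linear_combination - X j * X i ^ 2 * CharTwo.two_eq_zero (R := Poly)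
      simpa [this] using pow_mul_powSum_mem i j 0 4
  | n + 3 => add_mem (quadratic_mul_mem_powSumSpan (powSumScaled_mem i j (n + 2)))
      (pow_mul_mem_powSumSpan 2 (powSumScaled_mem i j n))

theorem symMon_mem (i j a b : ℕ) : symMon i j a b ∈ powSumSpan i j := by
  unfold symMon
  split_ifs
  · exact pow_mul_powSum_mem _ _ _ _
  · exact pow_mul_mem_powSumSpan _ (powSumScaled_mem _ _ _)

theorem X_mul_sym_mem {i j : ℕ} (hij : i ≠ j) (G : Poly) :
    X i * sym i j G ∈ relSubmodule i j := by
  induction G using MvPolynomial.induction_on' with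
  | monomial m a =>
    have hm : (monomial m a : Poly) = a • monomial m 1 := by simp [smul_monomial]
    rw [hm, map_smul, mul_smul_comm, sym_monomial]
    refine Submodule.smul_mem _ _ ?_
    have h := symMon_mem i j (m i) (m j)
    generalize symMon i j (m i) (m j) = f at h
    induction h using Submodule.span_induction with
    | mem f h =>
      obtain ⟨t, rfl⟩ := h
      exact monomial_mul_powSum_mem hij (by simp [Finsupp.erase_apply]) (by simp) _ _
    | zero => simp
    | add f g _ _ hf hg => rw [mul_add, mul_add]; exact add_mem hf hg
    | smul a f _ hf => rw [mul_smul_comm, mul_smul_comm]; exact Submodule.smul_mem _ _ hf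
  | add p q hp hq => rw [map_add, mul_add]; exact add_mem hp hq

/-- The substitution `x_k ↦ x_{k+1}`. -/
def shift : Poly →ₐ[ZMod 2] Poly := rename Nat.succ

@[simp] theorem shift_X (k : ℕ) : shift (X k) = X (k + 1) := by simp [shift]

theorem psi_shift (i j : ℕ) (p : Poly) : psi (i + 1) (j + 1) (shift p) = shift (psi i j p) := by
  suffices (psi (i + 1) (j + 1)).comp shift = shift.comp (psi i j) from
    DFunLike.congr_fun this p
  refine MvPolynomial.algHom_ext fun n => ?_
  by_cases h : n = j <;> simp [h]

theorem alphaHom_shift (i j : ℕ) (p : Poly) :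
    alphaHom (i + 1) (j + 1) (shift p) = shift (alphaHom i j p) := by
  suffices (alphaHom (i + 1) (j + 1)).comp shift = shift.comp (alphaHom i j) from
    DFunLike.congr_fun this p
  refine MvPolynomial.algHom_ext fun n => ?_
  by_cases h : n = i
  · simp [h]
  by_cases h' : n = j
  · by_cases h'' : j = i <;> simp [h', h'']
  · simp [h, h']

theorem betaHom_shift (i j : ℕ) (p : Poly) :
    betaHom (i + 1) (j + 1) (shift p) = shift (betaHom i j p) := by
  suffices (betaHom (i + 1) (j + 1)).comp shift = shift.comp (betaHom i j) from
    DFunLike.congr_fun this p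
  refine MvPolynomial.algHom_ext fun n => ?_
  by_cases h : n = i
  · simp [h]
  by_cases h' : n = j
  · by_cases h'' : j = i <;> simp [h', h'']
  · simp [h, h']

theorem sym_shift {i j : ℕ} (hij : i ≠ j) (p : Poly) :
    sym (i + 1) (j + 1) (shift p) = shift (sym i j p) := by
  have hij' : i + 1 ≠ j + 1 := by omega
  apply psi_injective hij'
  rw [psi_sym hij', psi_shift, psi_sym hij, alphaHom_shift, betaHom_shift, map_add]

theorem Inv.shift {i j : ℕ} {c : Poly} (hc : Inv i j c) :
    Inv (i + 1) (j + 1) (Behrens.shift c) := by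
  constructor
  · rw [alphaHom_shift, psi_shift, hc.1]
  · rw [betaHom_shift, psi_shift, hc.2]

theorem Inv.shift_shift (c : Poly) : Inv 0 1 (Behrens.shift (Behrens.shift c)) := by
  constructor
  · refine algHom_congr (f := (alphaHom 0 1).comp (Behrens.shift.comp Behrens.shift))
      (g := (psi 0 1).comp (Behrens.shift.comp Behrens.shift)) (fun n => ?_) c
    simp
  · refine algHom_congr (f := (betaHom 0 1).comp (Behrens.shift.comp Behrens.shift))
      (g := (psi 0 1).comp (Behrens.shift.comp Behrens.shift)) (fun n => ?_) c
    simp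

theorem sym_X_pow_mul_shift (j k : ℕ) (q : Poly) :
    sym (j + 1) (j + 2) (X 0 ^ k * shift q) = X 0 ^ k * shift (sym j (j + 1) q) := by
  rw [sym_mul (by omega) ((Inv.X (by omega) (by omega)).pow k), sym_shift (by omega)]

/-- The composite of the first `k` neighbouring symmetrization operators. -/
def pass : ℕ → Poly →ₗ[ZMod 2] Poly
  | 0 => LinearMap.id
  | k + 1 => sym k (k + 1) ∘ₗ pass k

theorem pass_succ (k : ℕ) (p : Poly) : pass (k + 1) p = sym k (k + 1) (pass k p) := rfl

theorem sym_pass {i j : ℕ} (hij : i ≠ j) (k : ℕ) (hi : k < i) (hj : k < j) (p : Poly) :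
    sym i j (pass k p) = pass k (sym i j p) := by
  induction k with
  | zero => rfl
  | succ k ih =>
    rw [pass_succ, pass_succ, sym_comm hij (by omega) (by omega) (by omega) (by omega) (by omega),
      ih (by omega) (by omega)]

theorem sym_pass_of_add_two_le (i k : ℕ) (hik : i + 2 ≤ k) (p : Poly) :
    sym i (i + 1) (pass k p) = pass k (sym (i + 1) (i + 2) p) := by
  induction k, hik using Nat.le_induction with
  | base =>
    rw [pass_succ, pass_succ, pass_succ, pass_succ,
      sym_braid (by omega) (by omega) (by omega), sym_pass (by omega) i (by omega) (by omega)]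
  | succ k hk ih =>
    rw [pass_succ, pass_succ,
      sym_comm (by omega) (by omega) (by omega) (by omega) (by omega) (by omega), ih]

/-- A symmetrized polynomial attached to a word. -/
def wordPoly : List ℕ → Poly
  | [] => 1
  | a :: l => pass l.length (X 0 ^ (a - l.length) * shift (wordPoly l))

theorem sym_wordPoly (L : List ℕ) (i : ℕ) (hi : i + 1 < L.length) :
    sym i (i + 1) (wordPoly L) = wordPoly L := by
  induction L generalizing i with
  | nil => simp at hi
  | cons a l ih =>
    rw [List.length_cons] at hi
    rw [wordPoly]
    rcases Nat.lt_or_ge (i + 1) l.length with h | h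
    · rw [sym_pass_of_add_two_le _ _ h, sym_X_pow_mul_shift, ih i h]
    · obtain h : l.length = i + 1 := by omega
      rw [h, pass_succ, sym_idem (by omega)]

/-- The monomial `x_0 ^ (m - 1) x_1 ^ (m - 2) ⋯`. -/
def staircase : ℕ → Poly
  | 0 => 1
  | m + 1 => X 0 ^ m * shift (staircase m)

theorem exists_staircase_eq (m i : ℕ) (hi : i + 1 < m) :
    ∃ c, staircase m = X i * c ∧ Inv i (i + 1) c := by
  induction i generalizing m with
  | zero =>
    obtain ⟨m, rfl⟩ := Nat.exists_eq_add_of_le' hi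
    refine ⟨(X 0 * X 1) ^ m * shift (shift (staircase m)),
      ?_, ((Inv.X_mul_X (by omega)).pow m).mul (Inv.shift_shift _)⟩
    simp only [staircase, map_mul, map_pow, shift_X]
    ring
  | succ i ih =>
    obtain ⟨m, rfl⟩ := Nat.exists_eq_add_of_le' (show 1 ≤ m by omega)
    obtain ⟨c, hc, hc'⟩ := ih m (by omega)
    refine ⟨X 0 ^ m * shift c, ?_, ((Inv.X (by omega) (by omega)).pow m).mul hc'.shift⟩
    rw [staircase, hc, map_mul, shift_X]
    ring

theorem staircase_mul_wordPoly_mem (L : List ℕ) (i : ℕ) (hi : i + 1 < L.length) :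
    staircase L.length * wordPoly L ∈ relSubmodule i (i + 1) := by
  obtain ⟨c, hc, hc'⟩ := exists_staircase_eq _ _ hi
  rw [hc, ← sym_wordPoly L i hi, mul_assoc, ← sym_mul (by omega) hc']
  exact X_mul_sym_mem (by omega) _

/-- The exponent vector of a word. -/
def exps : List ℕ → ℕ →₀ ℕ
  | [] => 0
  | a :: l => Finsupp.single 0 a + (exps l).mapDomain Nat.succ

theorem mapDomain_succ_apply_zero (m : ℕ →₀ ℕ) : m.mapDomain Nat.succ 0 = 0 :=
  Finsupp.mapDomain_of_notMem_range _ _ (by simp)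

theorem mapDomain_succ_apply_succ (m : ℕ →₀ ℕ) (n : ℕ) : m.mapDomain Nat.succ (n + 1) = m n :=
  Finsupp.mapDomain_apply Nat.succ_injective _ _

theorem exps_apply (l : List ℕ) (n : ℕ) : exps l n = l.getD n 0 := by
  induction l generalizing n with
  | nil => simp [exps]
  | cons a l ih =>
    rcases n with _ | n
    · simp [exps, mapDomain_succ_apply_zero]
    · simp [exps, mapDomain_succ_apply_succ, ih]

theorem exps_append (u v : List ℕ) (a b : ℕ) :
    exps (u ++ a :: b :: v) = exps (u ++ 0 :: 0 :: v) + Finsupp.single u.length a +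
      Finsupp.single (u.length + 1) b := by
  induction u with
  | nil =>
    simp [exps, Finsupp.mapDomain_add, Finsupp.mapDomain_single]
    abel
  | cons c u ih =>
    simp [exps, Finsupp.mapDomain_add, Finsupp.mapDomain_single, ih]
    abel

/-- The functional on words dual to the word `L`, up to lower terms. -/
def dual (L w : List ℕ) : ZMod 2 :=
  if w.length = L.length then coeff (exps w) (staircase L.length * wordPoly L) else 0

theorem dual_rel (L u v : List ℕ) {a b : ℕ} (hab : a ≤ b + 1) :
    (∑ c ∈ Finset.range (a + 2 * b), if 3 * c + 1 < a + 2 * b then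
      behrensCoeff a b c * dual L (u ++ (a + 2 * b - 2 * c) :: c :: v) else 0) =
      dual L (u ++ a :: b :: v) := by
  unfold dual
  by_cases h : (u ++ a :: b :: v).length = L.length
  · rw [if_pos h]
    have hi : u.length + 1 < L.length := by
      rw [← h]; simp
    have h' (c d : ℕ) : (u ++ c :: d :: v).length = L.length := by
      rw [← h]; simp
    have := staircase_mul_wordPoly_mem L u.length hi (exps (u ++ 0 :: 0 :: v)) a b
      (by simp [exps_apply]) (by simp [exps_apply]) hab
    rw [exps_append, ← this]
    refine Finset.sum_congr rfl fun c _ => ?_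
    rw [if_pos (h' _ _), exps_append]
  · rw [if_neg h]
    refine Finset.sum_eq_zero fun c _ => ?_
    have h' : ¬ (u ++ (a + 2 * b - 2 * c) :: c :: v).length = L.length := by simpa using h
    rw [if_neg h', mul_zero, ite_self]

/-- The polynomials of degree less than `c` in `x_0`. -/
def lower (c : ℕ) : Submodule (ZMod 2) Poly :=
  Submodule.span (ZMod 2) {f | ∃ k < c, ∃ q, f = X 0 ^ k * shift q}

theorem lower_mono {c d : ℕ} (h : c ≤ d) : lower c ≤ lower d :=
  Submodule.span_mono fun _ ⟨k, hk, q, hq⟩ => ⟨k, hk.trans_le h, q, hq⟩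

theorem X_pow_mul_shift_mem {k c : ℕ} (h : k < c) (q : Poly) : X 0 ^ k * shift q ∈ lower c :=
  Submodule.subset_span ⟨k, h, q, rfl⟩

theorem map_mem_of_mem_lower {c : ℕ} (T : Poly →ₗ[ZMod 2] Poly) (W : Submodule (ZMod 2) Poly)
    (h : ∀ k < c, ∀ q, T (X 0 ^ k * shift q) ∈ W) {f : Poly} (hf : f ∈ lower c) : T f ∈ W := by
  have : lower c ≤ W.comap T := Submodule.span_le.2 (by rintro _ ⟨k, hk, q, rfl⟩; exact h k hk q)
  exact this hf

theorem mul_mem_lower {b c : ℕ} (q : Poly) {f : Poly} (hf : f ∈ lower c) :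
    X 0 ^ b * shift q * f ∈ lower (b + c) := by
  refine map_mem_of_mem_lower (LinearMap.mulLeft (ZMod 2) (X 0 ^ b * shift q)) _
    (fun k hk p => ?_) hf
  have : X 0 ^ b * shift q * (X 0 ^ k * shift p) = X 0 ^ (b + k) * shift (q * p) := by
    rw [map_mul]; ring
  rw [LinearMap.mulLeft_apply, this]
  exact X_pow_mul_shift_mem (by omega) _

theorem sym_mem_lower {c : ℕ} (j : ℕ) {f : Poly} (hf : f ∈ lower c) :
    sym (j + 1) (j + 2) f ∈ lower c := by
  refine map_mem_of_mem_lower _ _ (fun k hk q => ?_) hf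
  rw [sym_X_pow_mul_shift]
  exact X_pow_mul_shift_mem hk _

theorem powSum_add_pow_mem : ∀ n, powSum 0 1 (n + 1) + X 0 ^ (n + 1) ∈ lower (n + 1)
  | 0 => by simp [powSum, add_self_poly]
  | 1 => by
      have : powSum 0 1 2 + X 0 ^ 2 = 0 := by
        simp only [powSum]
        linear_combination X 0 ^ 2 * CharTwo.two_eq_zero (R := Poly)
      rw [this]
      exact zero_mem _
  | n + 2 => by
      have h1 := mul_mem_lower (b := 1) 1 (powSum_add_pow_mem (n + 1))
      have h2 := mul_mem_lower (b := 0) (X 0) (powSum_add_pow_mem n)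
      have h3 := X_pow_mul_shift_mem (k := n + 1) (c := n + 3) (by omega) (X 0)
      have : powSum 0 1 (n + 3) + X 0 ^ (n + 3) =
          X 0 ^ 1 * shift 1 * (powSum 0 1 (n + 2) + X 0 ^ (n + 2)) +
          X 0 ^ 0 * shift (X 0) * (powSum 0 1 (n + 1) + X 0 ^ (n + 1)) +
          X 0 ^ (n + 1) * shift (X 0) := by
        rw [powSum]
        simp only [shift_X, map_one]
        linear_combination - (X 0 ^ (n + 1) * X 1) * CharTwo.two_eq_zero (R := Poly)
      rw [show n + 2 + 1 = n + 3 from rfl, this]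
      exact add_mem (add_mem (lower_mono (by omega) h1) (lower_mono (by omega) h2)) h3

theorem sym_zero_one_pow (b d : ℕ) :
    sym 0 1 (X 0 ^ (b + d) * X 1 ^ b) = (X 0 * X 1) ^ b * powSum 0 1 d := by
  have : (X 0 ^ (b + d) * X 1 ^ b : Poly) =
      monomial (Finsupp.single 0 (b + d) + Finsupp.single 1 b) 1 := by
    simp [X_pow_eq_monomial, monomial_mul]
  rw [this, sym_monomial]
  have : ((Finsupp.single 0 (b + d) + Finsupp.single 1 b : ℕ →₀ ℕ).erase 0).erase 1 = 0 := by
    ext n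
    simp only [Finsupp.erase_apply, Finsupp.add_apply, Finsupp.single_apply, Finsupp.zero_apply]
    split_ifs <;> omega
  rw [this]
  simp [symMon]

theorem sym_zero_one_add_mem {c : ℕ} {q : Poly} (hq : q ∈ lower c) :
    sym 0 1 (X 0 ^ c * shift q) + X 0 ^ c * shift q ∈ lower c := by
  refine map_mem_of_mem_lower
    ((sym 0 1 + LinearMap.id) ∘ₗ LinearMap.mulLeft (ZMod 2) (X 0 ^ c) ∘ₗ shift.toLinearMap) _
    (fun b hb p => ?_) hq
  obtain ⟨d, rfl⟩ := Nat.exists_eq_add_of_lt hb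
  simp only [LinearMap.comp_apply, LinearMap.add_apply, LinearMap.id_apply,
    LinearMap.mulLeft_apply, AlgHom.toLinearMap_apply, map_mul, map_pow, shift_X, zero_add]
  have h1 : X 0 ^ (b + d + 1) * (X 1 ^ b * shift (shift p)) =
      shift (shift p) * (X 0 ^ (b + (d + 1)) * X 1 ^ b) := by ring
  rw [h1, sym_mul (by omega) (Inv.shift_shift p), sym_zero_one_pow]
  have h2 := mul_mem_lower (b := b) (X 0 ^ b * shift p) (powSum_add_pow_mem d)
  simp only [map_mul, map_pow, shift_X, zero_add, ← add_assoc] at h2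
  convert h2 using 1
  ring

theorem pass_add_mem {c n : ℕ} {q : Poly} (hq : q ∈ lower c)
    (hsym : ∀ j, j + 1 < n → sym j (j + 1) q = q) (k : ℕ) (hk : k ≤ n) :
    pass k (X 0 ^ c * shift q) + X 0 ^ c * shift q ∈ lower c := by
  induction k with
  | zero =>
    rw [pass, LinearMap.id_apply, add_self_poly]
    exact zero_mem _
  | succ k ih =>
    rcases k with _ | k
    · exact sym_zero_one_add_mem hq
    · have := sym_mem_lower k (ih (by omega))
      rwa [map_add, sym_X_pow_mul_shift, hsym k (by omega)] at this

theorem length_le_of_admissible {a : ℕ} {l : List ℕ} (h : Admissible (a :: l)) :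
    l.length ≤ a := by
  induction l generalizing a with
  | nil => simp
  | cons b l ih =>
    have h1 := (List.isChain_cons_cons.1 h).1
    have h2 := ih (List.isChain_cons_cons.1 h).2
    rw [List.length_cons]
    omega

theorem wordPoly_add_mem {a : ℕ} {l : List ℕ} (h : Admissible (a :: l)) :
    wordPoly (a :: l) + X 0 ^ (a - l.length) * shift (wordPoly l) ∈ lower (a - l.length) := by
  induction l generalizing a with
  | nil =>
    have : wordPoly [a] = X 0 ^ (a - 0) * shift (wordPoly []) := rfl
    rw [this, List.length_nil, add_self_poly]
    exact zero_mem _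
  | cons b l ih =>
    have h1 := (List.isChain_cons_cons.1 h).1
    have h2 := (List.isChain_cons_cons.1 h).2
    have h3 := length_le_of_admissible h2
    refine pass_add_mem ?_ (sym_wordPoly (b :: l)) _ le_rfl
    have h4 := add_mem (lower_mono (Nat.le_succ _) (ih h2))
      (X_pow_mul_shift_mem (Nat.lt_succ_self (b - l.length)) (wordPoly l))
    rw [add_assoc, add_self_poly, add_zero] at h4
    exact lower_mono (by rw [List.length_cons]; omega) h4

theorem coeff_exps_cons (b k : ℕ) (w : List ℕ) (q : Poly) :
    coeff (exps (b :: w)) (X 0 ^ k * shift q) = if k = b then coeff (exps w) q else 0 := by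
  rw [X_pow_eq_monomial, coeff_monomial_mul', one_mul]
  have h0 : exps (b :: w) 0 = b := by simp [exps_apply]
  split_ifs with h1 h2 h2
  · subst h2
    rw [exps, add_tsub_cancel_left, shift, coeff_rename_mapDomain _ Nat.succ_injective]
  · refine coeff_rename_eq_zero _ _ _ fun u hu => ?_
    exfalso
    have h3 := DFunLike.congr_fun hu 0
    have h4 := h1 0
    rw [mapDomain_succ_apply_zero] at h3
    simp [h0] at h3 h4
    omega
  · subst h2
    exact absurd (by rw [exps]; exact le_self_add) h1
  · rfl

theorem coeff_exps_cons_of_mem_lower {a b : ℕ} (h : a ≤ b) (w : List ℕ) {f : Poly}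
    (hf : f ∈ lower a) : coeff (exps (b :: w)) f = 0 := by
  have : lcoeff (ZMod 2) (exps (b :: w)) f ∈ (⊥ : Submodule (ZMod 2) (ZMod 2)) := by
    induction hf using Submodule.span_induction with
    | mem f h' =>
      obtain ⟨k, hk, q, rfl⟩ := h'
      simp [coeff_exps_cons, (hk.trans_le h).ne]
    | zero => simp
    | add f g _ _ hf hg => rw [map_add]; exact add_mem hf hg
    | smul t f _ hf => rw [map_smul]; exact Submodule.smul_mem _ _ hf
  simpa using this

theorem coeff_staircase_mul_wordPoly {a b : ℕ} {l : List ℕ} (w : List ℕ)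
    (h : Admissible (a :: l)) (hab : a ≤ b) :
    coeff (exps (b :: w)) (staircase (a :: l).length * wordPoly (a :: l)) =
      if a = b then coeff (exps w) (staircase l.length * wordPoly l) else 0 := by
  have hl := length_le_of_admissible h
  have h1 := mul_mem_lower (b := l.length) (staircase l.length) (wordPoly_add_mem h)
  rw [Nat.add_sub_cancel' hl] at h1
  have h2 := coeff_exps_cons_of_mem_lower hab w h1
  rw [mul_add, coeff_add] at h2
  have h3 : X 0 ^ l.length * shift (staircase l.length) *
      (X 0 ^ (a - l.length) * shift (wordPoly l)) =
      X 0 ^ a * shift (staircase l.length * wordPoly l) := by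
    have : (X 0 ^ a : Poly) = X 0 ^ l.length * X 0 ^ (a - l.length) := by
      rw [← pow_add, Nat.add_sub_cancel' hl]
    rw [map_mul, this]
    ring
  rw [h3, coeff_exps_cons] at h2
  exact CharTwo.add_eq_zero.1 h2

theorem dual_self (L : List ℕ) (h : Admissible L) : dual L L = 1 := by
  rw [dual, if_pos rfl]
  induction L with
  | nil => simp [staircase, wordPoly, exps]
  | cons a l ih => rw [coeff_staircase_mul_wordPoly l h le_rfl, if_pos rfl, ih h.tail]

theorem le_of_dual_ne_zero (L w : List ℕ) (h : Admissible L) (hw : dual L w ≠ 0) : w ≤ L := by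
  unfold dual at hw
  split_ifs at hw with hlen
  · induction L generalizing w with
    | nil => simp_all
    | cons a l ih =>
      rcases w with _ | ⟨b, w⟩
      · simp at hlen
      rcases Nat.lt_or_ge b a with hab | hab
      · exact (List.cons_lt_cons_iff.2 (Or.inl hab)).le
      · rw [coeff_staircase_mul_wordPoly w h hab] at hw
        split_ifs at hw with hab'
        · subst hab'
          have := ih w h.tail (by simpa using hlen) hw
          rcases this.lt_or_eq with h' | rfl
          · exact (List.cons_lt_cons_iff.2 (Or.inr ⟨rfl, h'⟩)).le
          · exact le_rfl
        · exact absurd rfl hw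
  · exact absurd rfl hw

theorem mon_append_cons_cons (u v : List ℕ) (a b : ℕ) :
    mon (u ++ a :: b :: v) = mon u * (Q a * Q b) * mon v := by
  simp [mon, mul_assoc]

theorem basisFreeMonoid_eq_mon (w : FreeMonoid ℕ) :
    FreeAlgebra.basisFreeMonoid (ZMod 2) ℕ w = mon w.toList := by
  simp [FreeAlgebra.basisFreeMonoid, FreeAlgebra.equivMonoidAlgebraFreeMonoid,
    FreeMonoid.lift_apply, mon]
  rfl

theorem span_mon : Submodule.span (ZMod 2) (Set.range mon) = ⊤ := by
  rw [eq_top_iff, ← (FreeAlgebra.basisFreeMonoid (ZMod 2) ℕ).span_eq]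
  refine Submodule.span_mono ?_
  rintro _ ⟨w, rfl⟩
  exact ⟨_, (basisFreeMonoid_eq_mon w).symm⟩

/-- The linear functional on the free algebra extending `dual L`. -/
def dualFunctional (L : List ℕ) : FreeAlgebra (ZMod 2) ℕ →ₗ[ZMod 2] ZMod 2 :=
  (FreeAlgebra.basisFreeMonoid (ZMod 2) ℕ).constr (ZMod 2) fun w => dual L w.toList

theorem dualFunctional_mon (L w : List ℕ) : dualFunctional L (mon w) = dual L w := by
  have := (FreeAlgebra.basisFreeMonoid (ZMod 2) ℕ).constr_basis (ZMod 2)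
    (fun w => dual L w.toList) (FreeMonoid.ofList w)
  rwa [basisFreeMonoid_eq_mon] at this

theorem mon_mul_behrensRHS_mul_mon (u v : List ℕ) (a b : ℕ) :
    mon u * behrensRHS a b * mon v = ∑ c ∈ Finset.range (a + 2 * b),
      if 3 * c + 1 < a + 2 * b then
        behrensCoeff a b c • mon (u ++ (a + 2 * b - 2 * c) :: c :: v) else 0 := by
  rw [behrensRHS, Finset.mul_sum, Finset.sum_mul]
  refine Finset.sum_congr rfl fun c _ => ?_
  split_ifs
  · rw [mon_append_cons_cons, mul_smul_comm, smul_mul_assoc]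
  · rw [mul_zero, zero_mul]

theorem dualFunctional_mon_rel (L u v : List ℕ) {a b : ℕ} (hab : a ≤ b + 1) :
    dualFunctional L (mon u * (Q a * Q b) * mon v) =
      dualFunctional L (mon u * behrensRHS a b * mon v) := by
  rw [mon_mul_behrensRHS_mul_mon, ← mon_append_cons_cons, dualFunctional_mon, map_sum,
    ← dual_rel L u v hab]
  refine Finset.sum_congr rfl fun c _ => ?_
  split_ifs
  · rw [map_smul, dualFunctional_mon, smul_eq_mul]
  · rw [map_zero]

theorem dualFunctional_mul_rel (L : List ℕ) {a b : ℕ} (hab : a ≤ b + 1)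
    (u v : FreeAlgebra (ZMod 2) ℕ) :
    dualFunctional L (u * (Q a * Q b) * v) = dualFunctional L (u * behrensRHS a b * v) := by
  have hu : u ∈ Submodule.span (ZMod 2) (Set.range mon) := span_mon ▸ Submodule.mem_top
  have hv : v ∈ Submodule.span (ZMod 2) (Set.range mon) := span_mon ▸ Submodule.mem_top
  induction hu using Submodule.span_induction with
  | mem u h =>
    obtain ⟨u, rfl⟩ := h
    induction hv using Submodule.span_induction with
    | mem v h =>
      obtain ⟨v, rfl⟩ := h
      exact dualFunctional_mon_rel L u v hab
    | zero => simp
    | add x y _ _ hx hy => rw [mul_add, mul_add, map_add, map_add, hx, hy]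
    | smul t x _ hx => rw [mul_smul_comm, mul_smul_comm, map_smul, map_smul, hx]
  | zero => simp
  | add x y _ _ hx hy => simp only [add_mul, map_add, hx, hy]
  | smul t x _ hx => simp only [smul_mul_assoc, map_smul, hx]

theorem dualFunctional_congr (L : List ℕ) {x y : FreeAlgebra (ZMod 2) ℕ}
    (h : toBehrens x = toBehrens y) : dualFunctional L x = dualFunctional L y := by
  have hrel : ∀ x y : FreeAlgebra (ZMod 2) ℕ, RingQuot.Rel BehrensRel x y → ∀ u v,
      dualFunctional L (u * x * v) = dualFunctional L (u * y * v) := by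
    intro x y h
    induction h with
    | of h =>
      obtain ⟨a, b, hab⟩ := h
      exact dualFunctional_mul_rel L hab
    | add_left _ ih => intro u v; simp only [mul_add, add_mul, map_add, ih]
    | mul_left _ ih => intro u v; simpa only [mul_assoc] using ih u (_ * v)
    | mul_right _ ih => intro u v; simpa only [mul_assoc] using ih (u * _) v
  have hquot : Quot.mk (RingQuot.Rel BehrensRel) x = Quot.mk _ y := by
    simpa [toBehrens, RingQuot.mkAlgHom_def, RingQuot.mkRingHom_def] using h
  clear h
  induction Quot.eqvGen_exact hquot with
  | rel x y h => simpa using hrel x y h 1 1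
  | refl => rfl
  | symm x y h ih => exact (ih (Quot.eqvGen_sound h)).symm
  | trans x y z h1 h2 ih1 ih2 =>
    exact (ih1 (Quot.eqvGen_sound h1)).trans (ih2 (Quot.eqvGen_sound h2))

theorem linearIndependent_mon : LinearIndependent (ZMod 2)
    (fun L : {L : List ℕ // Admissible L} => toBehrens (mon L.1)) := by
  rw [linearIndependent_iff']
  intro s g hg
  by_contra! hne
  have hne' : (s.filter fun L => g L ≠ 0).Nonempty := by
    obtain ⟨L, hL, hL'⟩ := hne
    exact ⟨L, Finset.mem_filter.2 ⟨hL, hL'⟩⟩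
  obtain ⟨L, hL, hmin⟩ := Finset.exists_min_image _ (fun L => L.1) hne'
  obtain ⟨hLs, hL0⟩ := Finset.mem_filter.1 hL
  have h0 : dualFunctional L.1 (∑ i ∈ s, g i • mon i.1) = 0 := by
    rw [← map_zero (dualFunctional L.1)]
    refine dualFunctional_congr _ ?_
    rw [map_zero, map_sum, ← hg]
    simp only [map_smul]
  simp only [map_sum, map_smul, dualFunctional_mon, smul_eq_mul] at h0
  rw [Finset.sum_eq_single_of_mem L hLs, dual_self _ L.2, mul_one] at h0
  · exact hL0 h0
  · intro w hw hwL
    by_contra h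
    obtain ⟨h1, h2⟩ := mul_ne_zero_iff.1 h
    have h3 := le_of_dual_ne_zero _ _ L.2 h2
    exact hwL (Subtype.ext (le_antisymm h3 (hmin w (Finset.mem_filter.2 ⟨hw, h1⟩))))

/-- The weight of a word, preserved by the Behrens relations. -/
def weight : List ℕ → ℕ
  | [] => 0
  | a :: l => a + 2 * weight l

theorem sum_le_weight (l : List ℕ) : l.sum ≤ weight l := by
  induction l with
  | nil => rfl
  | cons a l ih => rw [weight, List.sum_cons]; omega

theorem weight_append (u v : List ℕ) : weight (u ++ v) = weight u + 2 ^ u.length * weight v := by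
  induction u with
  | nil => simp [weight]
  | cons a u ih =>
    rw [List.cons_append, weight, weight, ih, List.length_cons, pow_succ]
    ring

theorem exists_of_not_admissible {l : List ℕ} (h : ¬ Admissible l) :
    ∃ u v a b, l = u ++ a :: b :: v ∧ a ≤ b + 1 := by
  induction l with
  | nil => exact absurd List.isChain_nil h
  | cons a l ih =>
    rcases l with _ | ⟨b, l⟩
    · exact absurd (List.isChain_singleton a) h
    · by_cases hab : a ≤ b + 1
      · exact ⟨[], l, a, b, rfl, hab⟩
      · have : ¬ Admissible (b :: l) := fun h' => h (List.isChain_cons_cons.2 ⟨by omega, h'⟩)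
        obtain ⟨u, v, c, d, huv, hcd⟩ := ih this
        exact ⟨a :: u, v, c, d, by rw [huv, List.cons_append], hcd⟩

theorem toBehrens_mon_mem (w : List ℕ) : toBehrens (mon w) ∈ Submodule.span (ZMod 2)
    (Set.range fun L : {L : List ℕ // Admissible L} => toBehrens (mon L.1)) := by
  induction hn : weight w - w.sum using Nat.strong_induction_on generalizing w with
  | _ n ih =>
  by_cases hw : Admissible w
  · exact Submodule.subset_span ⟨⟨w, hw⟩, rfl⟩
  obtain ⟨u, v, a, b, rfl, hab⟩ := exists_of_not_admissible hw
  have hrel : toBehrens (Q a * Q b) = toBehrens (behrensRHS a b) :=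
    RingQuot.mkAlgHom_rel _ (BehrensRel.mk a b hab)
  rw [mon_append_cons_cons, map_mul, map_mul, hrel, ← map_mul, ← map_mul,
    mon_mul_behrensRHS_mul_mon, map_sum]
  refine Submodule.sum_mem _ fun c _ => ?_
  split_ifs with hc
  · rw [map_smul]
    refine Submodule.smul_mem _ _ (ih _ ?_ _ rfl)
    have h1 := sum_le_weight (u ++ (a + 2 * b - 2 * c) :: c :: v)
    have h2 : weight (u ++ (a + 2 * b - 2 * c) :: c :: v) = weight (u ++ a :: b :: v) := by
      rw [weight_append, weight_append]
      congr 2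
      simp only [weight]
      omega
    simp only [List.sum_append, List.sum_cons] at h1 hn ⊢
    omega
  · rw [map_zero]
    exact zero_mem _

theorem span_toBehrens_mon : Submodule.span (ZMod 2)
    (Set.range fun L : {L : List ℕ // Admissible L} => toBehrens (mon L.1)) = ⊤ := by
  have hsurj : LinearMap.range toBehrens.toLinearMap = ⊤ :=
    LinearMap.range_eq_top.2 (RingQuot.mkAlgHom_surjective (ZMod 2) BehrensRel)
  rw [eq_top_iff, ← hsurj, LinearMap.range_eq_map, ← span_mon, Submodule.map_span,
    Submodule.span_le]
  rintro _ ⟨_, ⟨w, rfl⟩, rfl⟩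
  exact toBehrens_mon_mem w

end Behrens

theorem admissible_monomials_linearIndependent :
    LinearIndependent (ZMod 2)
      (fun L : {L : List ℕ // Admissible L} => toBehrens (mon L.1)) ∧
    Submodule.span (ZMod 2)
      (Set.range fun L : {L : List ℕ // Admissible L} => toBehrens (mon L.1)) = ⊤ := by
  exact ⟨Behrens.linearIndependent_mon, Behrens.span_toBehrens_mon⟩

end
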